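/- Let c ∈ (0, 1/2) and let n be an integer with 3 ≤ ξ(c) ≤ n. Then φ_3(n,c) = φ_3(c). -/

import Mathlib

/-- The multilinear form `L_r(A, x)` of an `n × n` matrix `A` and a vector `x`. -/
noncomputable def L (n r : ℕ) (A : Fin n → Fin n → ℝ) (x : Fin n → ℝ) : ℝ :=
  ∑ X ∈ Finset.powersetCard r (Finset.univ : Finset (Fin n)),
    (∏ i ∈ X, ∏ j ∈ X.filter (fun j => i < j), A i j) * ∏ i ∈ X, x i

/-- `(A, x) ∈ 𝒮_n(c)`: `A` is symmetric with zero diagonal and entries in `[0,1]`,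
`x` is nonnegative, `L_1(A,x) = 1` and `L_2(A,x) = c`. -/
noncomputable def memS (n : ℕ) (c : ℝ) (A : Fin n → Fin n → ℝ) (x : Fin n → ℝ) : Prop :=
  (∀ i, A i i = 0) ∧ (∀ i j, 0 ≤ A i j) ∧ (∀ i j, A i j ≤ 1) ∧ (∀ i j, A i j = A j i) ∧
    (∀ i, 0 ≤ x i) ∧ L n 1 A x = 1 ∧ L n 2 A x = c

/-- `ξ(c) = ⌈1/(1 - 2c)⌉`. -/
noncomputable def xi (c : ℝ) : ℕ := ⌈1 / (1 - 2 * c)⌉₊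

/-- `φ_r(n, c) = min { L_r(A, x) : r ≤ k ≤ n, (A, x) ∈ 𝒮_k(c) }`. -/
noncomputable def phi (r n : ℕ) (c : ℝ) : ℝ :=
  sInf {v : ℝ | ∃ k, r ≤ k ∧ k ≤ n ∧ ∃ (A : Fin k → Fin k → ℝ) (x : Fin k → ℝ),
    memS k c A x ∧ L k r A x = v}

/-- `√(1 - 2 ξ(c) c / (ξ(c) - 1))`. -/
noncomputable def sqc (c : ℝ) : ℝ :=
  Real.sqrt (1 - 2 * (xi c : ℝ) * c / ((xi c : ℝ) - 1))

/-- The large coordinate `x` of the optimal vector `x_c`. -/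
noncomputable def xval (c : ℝ) : ℝ := 1 / (xi c : ℝ) + (1 / (xi c : ℝ)) * sqc c

/-- The small coordinate `y` of the optimal vector `x_c`. -/
noncomputable def yval (c : ℝ) : ℝ :=
  1 / (xi c : ℝ) - (((xi c : ℝ) - 1) / (xi c : ℝ)) * sqc c

/-- `φ_r(c) = C(s-1, r) x^r + C(s-1, r-1) x^{r-1} y` where `s = ξ(c)`. -/
noncomputable def phiF (r : ℕ) (c : ℝ) : ℝ :=
  ((xi c - 1).choose r : ℝ) * xval c ^ r +
    ((xi c - 1).choose (r - 1) : ℝ) * xval c ^ (r - 1) * yval c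


/-- Edge weight of the complete multipartite weighting with total weight `d`, `q` parts of
weight `u` and one further part of weight `d - q * u`. -/
noncomputable def scallopEdge (q d u : ℝ) : ℝ := q * u * d - q * (q + 1) / 2 * u ^ 2

/-- Triangle weight of the complete multipartite weighting with total weight `d`, `q` parts of
weight `u` and one further part of weight `d - q * u`. -/
noncomputable def scallopTri (q d u : ℝ) : ℝ :=
  q * (q - 1) / 2 * u ^ 2 * (d - 2 * (q + 1) / 3 * u)

theorem scallopTri_sub_le {q d u x : ℝ} (hq : 1 ≤ q)
    (h : 0 ≤ (u - x) * (3 * (d / q - d / (q + 1)) * ((u - d / (q + 1)) - (d / (q + 1) - x)) -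
      2 * ((u - d / (q + 1)) ^ 2 - (u - d / (q + 1)) * (d / (q + 1) - x) +
        (d / (q + 1) - x) ^ 2))) :
    (q - 1) / q * d * (scallopEdge q d u - scallopEdge q d x) ≤
      scallopTri q d u - scallopTri q d x := by
  have hq0 : 0 < q := by linarith
  have key : scallopTri q d u - scallopTri q d x -
      (q - 1) / q * d * (scallopEdge q d u - scallopEdge q d x) =
      q * (q - 1) * (q + 1) / 6 *
      ((u - x) * (3 * (d / q - d / (q + 1)) * ((u - d / (q + 1)) - (d / (q + 1) - x)) -
      2 * ((u - d / (q + 1)) ^ 2 - (u - d / (q + 1)) * (d / (q + 1) - x) +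
        (d / (q + 1) - x) ^ 2))) := by
    unfold scallopTri scallopEdge
    field_simp
    ring
  have : 0 ≤ q * (q - 1) * (q + 1) / 6 := by
    have : 0 ≤ q - 1 := by linarith
    positivity
  nlinarith [mul_nonneg this h]

/-- Degree excess bound. -/
theorem two_mul_excess_le {q d x y δ : ℝ} (hq : 1 ≤ q) (hx : 0 < x) (hy : 0 ≤ y) (hyx : y ≤ x)
    (hx1 : (q + 1) * x ≤ 1) (hδ : δ ≤ (q + 1) * x * y * (x - y) ^ 2)
    (hT : q * (q + 1) * x * (d / (q + 1) - x) ≤ 2 * δ) :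
    2 * (d / (q + 1) - x) ≤ d / q - d / (q + 1) := by
  have hq0 : 0 < q := by linarith
  set a := d / (q + 1) - x with ha
  have hd : d = (q + 1) * (x + a) := by rw [ha]; field_simp; ring
  have hE : d / q - d / (q + 1) = (x + a) / q := by rw [hd]; field_simp; ring
  rw [hE, le_div_iff₀ hq0]
  have h1 : q * a ≤ 2 * (y * (x - y) ^ 2) := by
    have : (q + 1) * x * (q * a) ≤ (q + 1) * x * (2 * (y * (x - y) ^ 2)) := by nlinarith
    exact le_of_mul_le_mul_left this (by positivity)
  have hx2 : x ≤ 1 / 2 := by nlinarith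
  rcases le_or_gt a 0 with h | h
  · by_cases hxa : 0 ≤ x + a
    · nlinarith
    · push Not at hxa
      nlinarith
  · have h2 : y * (x - y) ≤ x ^ 2 / 4 := by nlinarith [sq_nonneg (x - 2 * y)]
    have h3 : y * (x - y) ^ 2 ≤ x ^ 2 / 4 * x := by
      have : y * (x - y) * (x - y) ≤ x ^ 2 / 4 * x :=
        mul_le_mul h2 (by linarith) (by linarith) (by positivity)
      nlinarith
    have h4 : x ^ 2 / 4 * x ≤ x / 16 := by nlinarith [sq_nonneg x]
    nlinarith

theorem scallopTri_lower_of_goodman {q d x y δ T Q : ℝ} (hq : 1 ≤ q) (hd0 : 0 ≤ d) (hd1 : d ≤ 1)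
    (hx : 0 < x) (hy : 0 ≤ y) (hyx : y ≤ x) (hx1 : (q + 1) * x ≤ 1) (hδ0 : 0 ≤ δ)
    (hδ : δ ≤ (q + 1) * x * y * (x - y) ^ 2) (hT : T = scallopEdge q d x - δ)
    (hT2 : 2 * T ≤ q * x * d) (hTq : T ≤ (q - 1) / (2 * q) * d ^ 2) (hQ : 0 ≤ Q)
    (hG : T * (4 * T - d ^ 2) ≤ 3 * d * Q) :
    scallopTri q d x - (q - 1) / q * δ ≤ Q := by
  have hq0 : 0 < q := by linarith
  have hq1 : 0 ≤ q - 1 := by linarith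
  have hκ : 0 ≤ (q - 1) / q := by positivity
  rcases hd0.eq_or_lt with rfl | hd
  · have : scallopTri q 0 x ≤ 0 := by
      unfold scallopTri
      have : 0 ≤ q * (q - 1) / 2 * x ^ 2 * (2 * (q + 1) / 3 * x) := by positivity
      linarith
    have := mul_nonneg hκ hδ0
    linarith
  have hax : q * (q + 1) * x * (d / (q + 1) - x) ≤ 2 * δ := by
    have : q * (q + 1) * x * (d / (q + 1) - x) = q * x * d - q * (q + 1) * x ^ 2 := by
      field_simp
    rw [this]
    unfold scallopEdge at hT
    linarith
  have haE := two_mul_excess_le hq hx hy hyx hx1 hδ hax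
  have h1 : (q - 1) / q * d * (scallopEdge q d (d / q) - scallopEdge q d x) ≤
      scallopTri q d (d / q) - scallopTri q d x := by
    apply scallopTri_sub_le hq
    have : (d / q - x) * (3 * (d / q - d / (q + 1)) * ((d / q - d / (q + 1)) - (d / (q + 1) - x)) -
      2 * ((d / q - d / (q + 1)) ^ 2 - (d / q - d / (q + 1)) * (d / (q + 1) - x) +
        (d / (q + 1) - x) ^ 2)) =
        (d / q - x) ^ 2 * (d / q - d / (q + 1) - 2 * (d / (q + 1) - x)) := by ring
    rw [this]
    exact mul_nonneg (sq_nonneg _) (by linarith)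
  have hE : scallopEdge q d (d / q) = (q - 1) / (2 * q) * d ^ 2 := by
    unfold scallopEdge; field_simp; ring
  have hP : scallopTri q d (d / q) = (q - 1) * (q - 2) / (6 * q ^ 2) * d ^ 3 := by
    unfold scallopTri; field_simp; ring
  have h2 : scallopTri q d (d / q) - (q - 1) / q * d * (scallopEdge q d (d / q) - T) ≤ Q := by
    rw [hE, hP]
    refine le_of_mul_le_mul_left (le_trans ?_ hG) (show 0 < 3 * d by positivity)
    have : T * (4 * T - d ^ 2) - 3 * d * ((q - 1) * (q - 2) / (6 * q ^ 2) * d ^ 3 -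
        (q - 1) / q * d * ((q - 1) / (2 * q) * d ^ 2 - T)) =
        4 * ((q - 1) / (2 * q) * d ^ 2 - T) ^ 2 + d ^ 2 / q * ((q - 1) / (2 * q) * d ^ 2 - T) := by
      field_simp
      ring
    have h0 : 0 ≤ (q - 1) / (2 * q) * d ^ 2 - T := by linarith
    have : 0 ≤ d ^ 2 / q * ((q - 1) / (2 * q) * d ^ 2 - T) := by positivity
    nlinarith
  have h3 : (q - 1) / q * d * δ ≤ (q - 1) / q * δ := by
    have := mul_le_mul_of_nonneg_left hd1 (mul_nonneg hκ hδ0)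
    linarith
  have h4 : δ = scallopEdge q d x - T := by linarith
  rw [h4] at h3 ⊢
  linarith

theorem scallopTri_lower_of_scallop {q d x δ u : ℝ} (hq : 2 ≤ q) (hd0 : 0 ≤ d) (hd1 : d ≤ 1)
    (hx : 0 < x) (hδ0 : 0 ≤ δ) (hT : scallopEdge q d u = scallopEdge q d x - δ)
    (hT2 : 2 * scallopEdge q d u ≤ q * x * d) (hu : d / (q + 1) ≤ u) (hu' : u ≤ d / q) :
    scallopTri q d x - (q - 1) / q * δ ≤ scallopTri q d u := by
  have hq0 : 0 < q := by linarith
  have hq1 : 0 ≤ q - 1 := by linarith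
  have hκ : 0 ≤ (q - 1) / q := by positivity
  have h1 : (q - 1) / q * d * (scallopEdge q d u - scallopEdge q d x) ≤
      scallopTri q d u - scallopTri q d x := by
    apply scallopTri_sub_le (by linarith)
    obtain ⟨z, hz⟩ : ∃ z, z = d / (q + 1) := ⟨_, rfl⟩
    have hz0 : 0 ≤ z := by rw [hz]; positivity
    rw [← hz] at hu ⊢
    have hdz : d = (q + 1) * z := by rw [hz]; field_simp
    have hE : d / q - z = z / q := by rw [hdz]; field_simp; ring
    have hu2 : u - z ≤ z / q := by linarith
    rw [hE]
    have hδe : 2 * δ = q * (q + 1) * ((u - z) ^ 2 - (z - x) ^ 2) := by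
      unfold scallopEdge at hT
      rw [hdz] at hT
      linear_combination 2 * hT
    have hq2 : 0 < q * (q + 1) := by positivity
    have hab : (z - x) ^ 2 ≤ (u - z) ^ 2 := by
      by_contra! hcon
      nlinarith
    have habs := abs_le_of_sq_le_sq' hab (by linarith)
    have haz : (z - x) * z ≤ (u - z) ^ 2 := by
      have : q * (q + 1) * x * (z - x) ≤ q * (q + 1) * ((u - z) ^ 2 - (z - x) ^ 2) := by
        rw [← hδe]
        rw [hT] at hT2
        unfold scallopEdge at hT2
        rw [hdz] at hT2
        nlinarith
      have : x * (z - x) ≤ (u - z) ^ 2 - (z - x) ^ 2 := by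
        refine le_of_mul_le_mul_left ?_ hq2
        linarith
      nlinarith
    have hb : 0 ≤ u - z := by linarith
    have hbz : (u - z) * 2 ≤ z := by
      rw [le_div_iff₀ hq0] at hu2
      nlinarith
    have ha2 : 2 * (z - x) ≤ u - z := by
      by_contra! hcon
      rcases hb.eq_or_lt with hb0 | hb0
      · rw [← hb0] at habs hcon
        linarith
      · nlinarith
    have hux : u - x = (u - z) + (z - x) := by ring
    rw [hux]
    generalize z - x = a at *
    generalize u - z = b at *
    refine mul_nonneg (by linarith) ?_
    have h3 : 3 * b * (b - a) ≤ 3 * (z / q) * (b - a) :=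
      mul_le_mul_of_nonneg_right (by linarith) (by linarith)
    nlinarith
  have h3 : (q - 1) / q * d * δ ≤ (q - 1) / q * δ := by
    have := mul_le_mul_of_nonneg_left hd1 (mul_nonneg hκ hδ0)
    linarith
  have h4 : δ = scallopEdge q d x - scallopEdge q d u := by linarith
  rw [h4] at h3 ⊢
  linarith

theorem scallopTri_le_of_quad_bound {q x t : ℝ} (hq : 1 ≤ q) (hx1 : (q + 1) * x ≤ 1)
    (hx2 : 1 ≤ (q + 2) * x)
    (h : scallopTri q (2 * scallopEdge (q + 1) 1 x) x -
      (q - 1) / q * (3 * (scallopTri (q + 1) 1 x - t)) ≤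
      (3 * (q * x) - 2) * t + q * x * scallopEdge (q + 1) 1 x +
        2 * (3 * t - 2 * (q * x) * scallopEdge (q + 1) 1 x) * scallopEdge (q + 1) 1 x) :
    scallopTri (q + 1) 1 x ≤ t := by
  have hq0 : 0 < q := by linarith
  by_contra! hlt
  have h1 : scallopTri q (2 * scallopEdge (q + 1) 1 x) x =
      (3 * (q * x) - 2) * scallopTri (q + 1) 1 x + q * x * scallopEdge (q + 1) 1 x +
        2 * (3 * scallopTri (q + 1) 1 x - 2 * (q * x) * scallopEdge (q + 1) 1 x) *
          scallopEdge (q + 1) 1 x := by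
    unfold scallopTri scallopEdge
    ring
  have h2 : 3 * (q - 1) / q < 3 * (q * x) - 2 + 6 * scallopEdge (q + 1) 1 x := by
    rw [div_lt_iff₀ hq0]
    have h3 : 0 ≤ (1 - (q + 1) * x) * ((q + 2) * x - 1) :=
      mul_nonneg (by linarith) (by linarith)
    have hc : 2 * scallopEdge (q + 1) 1 x = 1 - x + (1 - (q + 1) * x) * ((q + 2) * x - 1) := by
      unfold scallopEdge
      ring
    have h5 : 3 * (q - 1) < q * (3 * (q - 1) * x + 1) := by
      have h6 : 0 ≤ 3 * q * (q - 1) * ((q + 2) * x - 1) :=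
        mul_nonneg (mul_nonneg (by positivity) (by linarith)) (by linarith)
      refine lt_of_mul_lt_mul_left (a := q + 2) ?_ (by positivity)
      nlinarith [sq_nonneg (q - 2)]
    have h7 := mul_nonneg h3 hq0.le
    nlinarith
  rw [h1] at h
  have h4 : (q - 1) / q * (3 * (scallopTri (q + 1) 1 x - t)) =
      3 * (q - 1) / q * (scallopTri (q + 1) 1 x - t) := by ring
  nlinarith

/-- The bilinear form with kernel `A`. -/
noncomputable def edgeForm {n : ℕ} (A : Fin n → Fin n → ℝ) (u v : Fin n → ℝ) : ℝ :=
  ∑ i, ∑ j, A i j * (u i * v j)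

/-- The trilinear form whose kernel is the triangle weight of `A`. -/
noncomputable def triForm {n : ℕ} (A : Fin n → Fin n → ℝ) (u v w : Fin n → ℝ) : ℝ :=
  ∑ i, ∑ j, ∑ k, A i j * A j k * A i k * (u i * v j * w k)

/-- The weighted degree of `i`. -/
noncomputable def wdeg {n : ℕ} (A : Fin n → Fin n → ℝ) (x : Fin n → ℝ) (i : Fin n) : ℝ :=
  ∑ j, A i j * x j

/-- The weighted codegree of `i` and `j`. -/
noncomputable def wcodeg {n : ℕ} (A : Fin n → Fin n → ℝ) (x : Fin n → ℝ) (i j : Fin n) : ℝ :=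
  ∑ k, A i k * A j k * x k

/-- The weights `x` restricted to the neighbourhood of `i`. -/
def linkWeight {n : ℕ} (A : Fin n → Fin n → ℝ) (x : Fin n → ℝ) (i : Fin n) : Fin n → ℝ :=
  fun j => A i j * x j

/-- Symmetric kernels with zero diagonal and entries in `[0, 1]`. -/
structure IsKernel {n : ℕ} (A : Fin n → Fin n → ℝ) : Prop where
  diag : ∀ i, A i i = 0
  nonneg : ∀ i j, 0 ≤ A i j
  le_one : ∀ i j, A i j ≤ 1
  symm : ∀ i j, A i j = A j i

section

variable {n : ℕ} {A : Fin n → Fin n → ℝ}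

theorem triForm_swap_left (hA : ∀ i j, A i j = A j i) (u v w : Fin n → ℝ) :
    triForm A u v w = triForm A v u w := by
  unfold triForm
  rw [Finset.sum_comm]
  refine Finset.sum_congr rfl fun i _ => Finset.sum_congr rfl fun j _ =>
    Finset.sum_congr rfl fun k _ => ?_
  rw [hA j i]
  ring

theorem triForm_swap_right (hA : ∀ i j, A i j = A j i) (u v w : Fin n → ℝ) :
    triForm A u v w = triForm A u w v := by
  unfold triForm
  refine Finset.sum_congr rfl fun i _ => ?_
  rw [Finset.sum_comm]
  refine Finset.sum_congr rfl fun j _ => Finset.sum_congr rfl fun k _ => ?_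
  rw [hA k j]
  ring

theorem triForm_sub_left (u u' v w : Fin n → ℝ) :
    triForm A (u - u') v w = triForm A u v w - triForm A u' v w := by
  simp only [triForm, ← Finset.sum_sub_distrib, Pi.sub_apply]
  refine Finset.sum_congr rfl fun i _ => Finset.sum_congr rfl fun j _ =>
    Finset.sum_congr rfl fun k _ => ?_
  ring

theorem triForm_smul_left (t : ℝ) (u v w : Fin n → ℝ) :
    triForm A (t • u) v w = t * triForm A u v w := by
  simp only [triForm, Finset.mul_sum, Pi.smul_apply, smul_eq_mul]
  refine Finset.sum_congr rfl fun i _ => Finset.sum_congr rfl fun j _ =>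
    Finset.sum_congr rfl fun k _ => ?_
  ring

theorem triForm_sub_self (hA : ∀ i j, A i j = A j i) (u v : Fin n → ℝ) :
    triForm A (u - v) (u - v) (u - v) =
      triForm A u u u - 3 * triForm A v u u + 3 * triForm A v v u - triForm A v v v := by
  have h2 (a b c d : Fin n → ℝ) : triForm A a (b - c) d = triForm A a b d - triForm A a c d := by
    rw [triForm_swap_left hA, triForm_sub_left, triForm_swap_left hA b, triForm_swap_left hA c]
  have h3 (a b c d : Fin n → ℝ) : triForm A a d (b - c) = triForm A a d b - triForm A a d c := by
    rw [triForm_swap_right hA, h2, triForm_swap_right hA _ b, triForm_swap_right hA _ c]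
  simp only [triForm_sub_left, h2, h3]
  rw [triForm_swap_left hA u v u, triForm_swap_right hA u u v, triForm_swap_left hA u v u,
    triForm_swap_left hA u v v, triForm_swap_right hA v u v]
  ring

theorem triForm_nonneg (hA : IsKernel A) {u v w : Fin n → ℝ} (hu : ∀ i, 0 ≤ u i)
    (hv : ∀ i, 0 ≤ v i) (hw : ∀ i, 0 ≤ w i) : 0 ≤ triForm A u v w :=
  Finset.sum_nonneg fun i _ => Finset.sum_nonneg fun j _ => Finset.sum_nonneg fun k _ =>
    mul_nonneg (mul_nonneg (mul_nonneg (hA.nonneg _ _) (hA.nonneg _ _)) (hA.nonneg _ _))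
      (mul_nonneg (mul_nonneg (hu i) (hv j)) (hw k))

theorem edgeForm_eq_sum_wdeg (u x : Fin n → ℝ) : edgeForm A u x = ∑ i, u i * wdeg A x i := by
  simp only [edgeForm, wdeg, Finset.mul_sum]
  refine Finset.sum_congr rfl fun i _ => Finset.sum_congr rfl fun j _ => ?_
  ring

theorem sum_linkWeight (x : Fin n → ℝ) (i : Fin n) : ∑ j, linkWeight A x i j = wdeg A x i := rfl

theorem triForm_eq_sum_link (u x : Fin n → ℝ) :
    triForm A u x x = ∑ i, u i * edgeForm A (linkWeight A x i) (linkWeight A x i) := by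
  simp only [triForm, edgeForm, linkWeight, Finset.mul_sum]
  refine Finset.sum_congr rfl fun i _ => Finset.sum_congr rfl fun j _ =>
    Finset.sum_congr rfl fun k _ => ?_
  ring

theorem link_eq_sum_wcodeg (x : Fin n → ℝ) (i : Fin n) :
    edgeForm A (linkWeight A x i) (linkWeight A x i) = ∑ j, A i j * x j * wcodeg A x i j := by
  simp only [edgeForm, linkWeight, wcodeg, Finset.mul_sum]
  refine Finset.sum_congr rfl fun j _ => Finset.sum_congr rfl fun k _ => ?_
  ring

theorem sum_mul_triForm_link (hA : ∀ i j, A i j = A j i) (x : Fin n → ℝ) :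
    ∑ k, x k * triForm A (linkWeight A x k) x x =
      ∑ i, x i * wdeg A x i * edgeForm A (linkWeight A x i) (linkWeight A x i) := by
  simp only [triForm_eq_sum_link (linkWeight A x _), Finset.mul_sum]
  rw [Finset.sum_comm]
  refine Finset.sum_congr rfl fun i _ => ?_
  simp only [wdeg, Finset.mul_sum, Finset.sum_mul]
  refine Finset.sum_congr rfl fun j _ => ?_
  rw [linkWeight, hA i j]
  ring

theorem sum_mul_triForm_link_link (hA : ∀ i j, A i j = A j i) (x : Fin n → ℝ) :
    ∑ k, x k * triForm A (linkWeight A x k) (linkWeight A x k) x =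
      ∑ i, ∑ j, A i j * (x i * x j) * wcodeg A x i j ^ 2 := by
  simp only [triForm, Finset.mul_sum]
  rw [Finset.sum_comm]
  refine Finset.sum_congr rfl fun i _ => ?_
  rw [Finset.sum_comm]
  refine Finset.sum_congr rfl fun j _ => ?_
  rw [sq, wcodeg, Finset.sum_mul_sum, Finset.mul_sum]
  refine Finset.sum_congr rfl fun k _ => ?_
  rw [Finset.mul_sum]
  refine Finset.sum_congr rfl fun l _ => ?_
  rw [linkWeight, linkWeight, hA i k, hA j k]
  ring

/-- Upper bound for the weight of `K₄` coming from inclusion-exclusion over triangles. -/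
theorem sum_mul_triForm_link_le (hA : IsKernel A) {x : Fin n → ℝ} (hx : ∀ i, 0 ≤ x i)
    (h1 : ∑ i, x i = 1) :
    ∑ k, x k * triForm A (linkWeight A x k) (linkWeight A x k) (linkWeight A x k) ≤
      triForm A x x x -
        3 * ∑ i, x i * wdeg A x i * edgeForm A (linkWeight A x i) (linkWeight A x i) +
        3 * ∑ i, ∑ j, A i j * (x i * x j) * wcodeg A x i j ^ 2 := by
  rw [← sum_mul_triForm_link hA.symm, ← sum_mul_triForm_link_link hA.symm]
  have h : 0 ≤ ∑ k, x k * triForm A (x - linkWeight A x k) (x - linkWeight A x k)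
      (x - linkWeight A x k) := by
    refine Finset.sum_nonneg fun k _ => mul_nonneg (hx k) ?_
    have (i : Fin n) : 0 ≤ (x - linkWeight A x k) i := by
      have := mul_le_mul_of_nonneg_right (hA.le_one k i) (hx i)
      simp only [Pi.sub_apply, linkWeight]
      linarith
    exact triForm_nonneg hA this this this
  simp only [triForm_sub_self hA.symm, mul_sub, mul_add, Finset.sum_sub_distrib,
    Finset.sum_add_distrib, ← Finset.sum_mul, h1, mul_left_comm (x _) 3, ← Finset.mul_sum] at h
  linarith

theorem one_sub_wdeg_sub_wdeg_add_wcodeg_nonneg (hA : IsKernel A) {x : Fin n → ℝ}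
    (hx : ∀ i, 0 ≤ x i) (i j : Fin n) :
    0 ≤ ∑ k, x k - wdeg A x i - wdeg A x j + wcodeg A x i j := by
  have h : 0 ≤ ∑ k, x k * ((1 - A i k) * (1 - A j k)) :=
    Finset.sum_nonneg fun k _ => mul_nonneg (hx k)
      (mul_nonneg (by linarith [hA.le_one i k]) (by linarith [hA.le_one j k]))
  refine h.trans_eq ?_
  simp only [wdeg, wcodeg, ← Finset.sum_sub_distrib, ← Finset.sum_add_distrib]
  refine Finset.sum_congr rfl fun k _ => ?_
  ring

theorem sum_mul_wcodeg (x f : Fin n → ℝ) :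
    ∑ i, ∑ j, A i j * (x i * x j) * (f i * wcodeg A x i j) =
      ∑ i, x i * f i * edgeForm A (linkWeight A x i) (linkWeight A x i) := by
  simp only [link_eq_sum_wcodeg, Finset.mul_sum]
  refine Finset.sum_congr rfl fun i _ => Finset.sum_congr rfl fun j _ => ?_
  ring

theorem wcodeg_comm (x : Fin n → ℝ) (i j : Fin n) : wcodeg A x i j = wcodeg A x j i := by
  simp only [wcodeg, mul_comm (A i _)]

theorem sum_sum_swap (hA : ∀ i j, A i j = A j i) (x : Fin n → ℝ) (F : Fin n → Fin n → ℝ) :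
    ∑ i, ∑ j, A i j * (x i * x j) * F i j = ∑ i, ∑ j, A i j * (x i * x j) * F j i := by
  rw [Finset.sum_comm]
  refine Finset.sum_congr rfl fun i _ => Finset.sum_congr rfl fun j _ => ?_
  rw [hA j i]
  ring

theorem sum_sum_fst (x f : Fin n → ℝ) :
    ∑ i, ∑ j, A i j * (x i * x j) * f i = ∑ i, x i * wdeg A x i * f i := by
  simp only [wdeg, Finset.mul_sum, Finset.sum_mul]
  refine Finset.sum_congr rfl fun i _ => Finset.sum_congr rfl fun j _ => ?_
  ring

theorem triForm_eq_sum_wcodeg (x : Fin n → ℝ) :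
    triForm A x x x = ∑ i, ∑ j, A i j * (x i * x j) * wcodeg A x i j := by
  rw [triForm_eq_sum_link]
  have := sum_mul_wcodeg (A := A) x 1
  simpa using this.symm

/-- Goodman's bound. -/
theorem goodman (hA : IsKernel A) {x : Fin n → ℝ} (hx : ∀ i, 0 ≤ x i) :
    edgeForm A x x * (2 * edgeForm A x x - (∑ i, x i) ^ 2) ≤ (∑ i, x i) * triForm A x x x := by
  have h : 0 ≤ ∑ i, ∑ j, A i j * (x i * x j) *
      (∑ k, x k - wdeg A x i - wdeg A x j + wcodeg A x i j) :=
    Finset.sum_nonneg fun i _ => Finset.sum_nonneg fun j _ =>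
      mul_nonneg (mul_nonneg (hA.nonneg _ _) (mul_nonneg (hx _) (hx _)))
        (one_sub_wdeg_sub_wdeg_add_wcodeg_nonneg hA hx i j)
  simp only [mul_add, mul_sub, Finset.sum_add_distrib, Finset.sum_sub_distrib] at h
  rw [sum_sum_swap hA.symm x (fun i j => wdeg A x j), sum_sum_fst x (wdeg A x),
    ← triForm_eq_sum_wcodeg, sum_sum_fst x (fun _ => ∑ k, x k), ← Finset.sum_mul,
    ← edgeForm_eq_sum_wdeg] at h
  have hcs : edgeForm A x x ^ 2 ≤ (∑ i, x i) * ∑ i, x i * wdeg A x i * wdeg A x i := by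
    rw [edgeForm_eq_sum_wdeg]
    refine Finset.sum_sq_le_sum_mul_sum_of_sq_le_mul _ (fun i _ => hx i) (fun i _ => ?_)
      (fun i _ => le_of_eq (by ring))
    rw [mul_assoc]
    exact mul_nonneg (hx i) (mul_self_nonneg _)
  have hs : 0 ≤ ∑ i, x i := Finset.sum_nonneg fun i _ => hx i
  nlinarith

/-- Upper bound for the weight of `K₄` at a point satisfying the first order conditions of
minimality, with multipliers `lam` and `mu`. -/
theorem quad_le_of_stationary (hA : IsKernel A) {x : Fin n → ℝ} (hx : ∀ i, 0 ≤ x i)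
    (h1 : ∑ i, x i = 1) {lam mu : ℝ}
    (hdeg : ∀ i, 0 < x i →
      edgeForm A (linkWeight A x i) (linkWeight A x i) / 2 = lam * wdeg A x i + mu)
    (hcod : ∀ i j, 0 < x i → 0 < x j → 0 < A i j → wcodeg A x i j ≤ lam) :
    ∑ k, x k * triForm A (linkWeight A x k) (linkWeight A x k) (linkWeight A x k) ≤
      (3 * lam - 2) * triForm A x x x + 3 * lam * edgeForm A x x + 6 * mu * edgeForm A x x := by
  refine (sum_mul_triForm_link_le hA hx h1).trans ?_
  have h : 0 ≤ ∑ i, ∑ j, A i j * (x i * x j) *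
      ((lam - wcodeg A x i j) * (∑ k, x k - wdeg A x i - wdeg A x j + wcodeg A x i j)) := by
    refine Finset.sum_nonneg fun i _ => Finset.sum_nonneg fun j _ => ?_
    rcases (hA.nonneg i j).eq_or_lt with h0 | h0
    · simp [← h0]
    rcases (hx i).eq_or_lt with hi | hi
    · simp [← hi]
    rcases (hx j).eq_or_lt with hj | hj
    · simp [← hj]
    exact mul_nonneg (by positivity) (mul_nonneg (by linarith [hcod i j hi hj h0])
      (one_sub_wdeg_sub_wdeg_add_wcodeg_nonneg hA hx i j))
  have hexp : ∑ i, ∑ j, A i j * (x i * x j) *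
      ((lam - wcodeg A x i j) * (∑ k, x k - wdeg A x i - wdeg A x j + wcodeg A x i j)) =
      lam * edgeForm A x x - 2 * lam * ∑ i, x i * wdeg A x i * wdeg A x i +
        (lam - 1) * triForm A x x x +
        2 * ∑ i, x i * wdeg A x i * edgeForm A (linkWeight A x i) (linkWeight A x i) -
        ∑ i, ∑ j, A i j * (x i * x j) * wcodeg A x i j ^ 2 := by
    calc
      _ = ∑ i, ∑ j, (lam * (A i j * (x i * x j)) - lam * (A i j * (x i * x j) * wdeg A x i) -
          lam * (A i j * (x i * x j) * wdeg A x j) +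
          (lam - 1) * (A i j * (x i * x j) * wcodeg A x i j) +
          A i j * (x i * x j) * (wdeg A x i * wcodeg A x i j) +
          A i j * (x i * x j) * (wdeg A x j * wcodeg A x j i) -
          A i j * (x i * x j) * wcodeg A x i j ^ 2) := by
        refine Finset.sum_congr rfl fun i _ => Finset.sum_congr rfl fun j _ => ?_
        rw [h1, wcodeg_comm x j i]
        ring
      _ = _ := by
        simp only [Finset.sum_add_distrib, Finset.sum_sub_distrib, ← Finset.mul_sum]
        rw [← edgeForm, sum_sum_swap hA.symm x (fun i j => wdeg A x j),
          sum_sum_swap hA.symm x (fun i j => wdeg A x j * wcodeg A x j i),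
          sum_sum_fst x (wdeg A x), sum_mul_wcodeg x (wdeg A x),
          ← triForm_eq_sum_wcodeg]
        ring
  have hS : ∑ i, x i * wdeg A x i * edgeForm A (linkWeight A x i) (linkWeight A x i) =
      2 * lam * ∑ i, x i * wdeg A x i * wdeg A x i + 2 * mu * edgeForm A x x := by
    rw [edgeForm_eq_sum_wdeg x x, Finset.mul_sum, Finset.mul_sum, ← Finset.sum_add_distrib]
    refine Finset.sum_congr rfl fun i _ => ?_
    rcases (hx i).eq_or_lt with hi | hi
    · simp [← hi]
    · linear_combination 2 * x i * wdeg A x i * hdeg i hi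
  rw [hexp] at h
  linarith

end

/-- The larger root `u` of `scallopEdge P 1 u = c`. -/
noncomputable def scallopRoot (P c : ℝ) : ℝ := (1 + √(1 - 2 * (P + 1) * c / P)) / (P + 1)

theorem scallopRoot_scallopEdge {P u : ℝ} (hP : 1 ≤ P) (hu : 1 / (P + 1) ≤ u) :
    scallopRoot P (scallopEdge P 1 u) = u := by
  have hP0 : 0 < P := by linarith
  have h : 1 - 2 * (P + 1) * scallopEdge P 1 u / P = ((P + 1) * u - 1) ^ 2 := by
    unfold scallopEdge; field_simp; ring
  rw [div_le_iff₀ (by positivity)] at hu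
  rw [scallopRoot, h, Real.sqrt_sq (by linarith)]
  field_simp
  ring

theorem scallopRoot_spec {P c : ℝ} (hP : 1 ≤ P) (hc1 : (P - 1) / (2 * P) ≤ c)
    (hc2 : c ≤ P / (2 * (P + 1))) :
    1 / (P + 1) ≤ scallopRoot P c ∧ scallopRoot P c ≤ 1 / P ∧
      scallopEdge P 1 (scallopRoot P c) = c := by
  have hP0 : 0 < P := by linarith
  rw [le_div_iff₀ (by positivity)] at hc2
  rw [div_le_iff₀ (by positivity)] at hc1
  have h0 : 0 ≤ 1 - 2 * (P + 1) * c / P := by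
    rw [sub_nonneg, div_le_one hP0]
    linarith
  have hsq := Real.sq_sqrt h0
  have hs0 := Real.sqrt_nonneg (1 - 2 * (P + 1) * c / P)
  have hs1 : √(1 - 2 * (P + 1) * c / P) ≤ 1 / P := by
    rw [← abs_of_nonneg (show 0 ≤ 1 / P by positivity), ← Real.sqrt_sq_eq_abs]
    apply Real.sqrt_le_sqrt
    have h : 1 - 2 * (P + 1) * c / P - (1 / P) ^ 2 = (P + 1) / P ^ 2 * (P - 1 - c * (2 * P)) := by
      field_simp
      ring
    have : (P + 1) / P ^ 2 * (P - 1 - c * (2 * P)) ≤ 0 :=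
      mul_nonpos_of_nonneg_of_nonpos (by positivity) (by linarith)
    linarith
  refine ⟨?_, ?_, ?_⟩
  · unfold scallopRoot
    gcongr
    linarith
  · rw [scallopRoot, div_le_iff₀ (by positivity)]
    have : 1 / P * (P + 1) = 1 + 1 / P := by field_simp
    linarith
  · unfold scallopEdge scallopRoot
    generalize √(1 - 2 * (P + 1) * c / P) = s at *
    have : c = (1 - s ^ 2) * P / (2 * (P + 1)) := by
      rw [hsq]; field_simp; ring
    rw [this]
    field_simp
    ring

theorem hasDerivAt_scallop {P c : ℝ} (hP : 1 ≤ P) (hc : 1 / (P + 1) < scallopRoot P c) :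
    HasDerivAt (fun c => scallopTri P 1 (scallopRoot P c)) ((P - 1) * scallopRoot P c) c := by
  have hP0 : 0 < P := by linarith
  have hs : 0 < √(1 - 2 * (P + 1) * c / P) := by
    unfold scallopRoot at hc
    rw [div_lt_div_iff_of_pos_right (by positivity)] at hc
    linarith
  have h1 : HasDerivAt (fun c => 1 - 2 * (P + 1) * c / P) (-(2 * (P + 1) / P)) c := by
    have := (((hasDerivAt_id c).const_mul (2 * (P + 1))).div_const P).const_sub 1
    simpa using this
  have h2 := ((h1.sqrt (Real.sqrt_pos.1 hs).ne').const_add 1).div_const (P + 1)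
  have h3 : HasDerivAt (fun u => scallopTri P 1 u)
      (P * (P - 1) * scallopRoot P c * (1 - (P + 1) * scallopRoot P c)) (scallopRoot P c) := by
    unfold scallopTri
    have := (((hasDerivAt_pow 2 (scallopRoot P c)).const_mul (P * (P - 1) / 2)).mul
      (((hasDerivAt_id (scallopRoot P c)).const_mul (2 * (P + 1) / 3)).const_sub 1))
    refine this.congr_deriv ?_
    simp
    ring
  refine (h3.comp c h2).congr_deriv ?_
  unfold scallopRoot
  generalize √(1 - 2 * (P + 1) * c / P) = s at hs ⊢
  field_simp
  ring

theorem scallopTri_le_of_goodman {P u t : ℝ}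
    (hG : 2 * scallopEdge P 1 u * (2 * (2 * scallopEdge P 1 u) - 1) ≤ 6 * t) :
    3 * (scallopTri P 1 u - t) ≤ P * u * (1 - P * u) * (u - (1 - P * u)) ^ 2 := by
  have : 3 * scallopTri P 1 u - scallopEdge P 1 u * (2 * (2 * scallopEdge P 1 u) - 1) =
    P * u * (1 - P * u) * (u - (1 - P * u)) ^ 2 := by
    unfold scallopTri scallopEdge
    ring
  linarith

section

variable {n : ℕ} {A : Fin n → Fin n → ℝ}

theorem edgeForm_swap (hA : ∀ i j, A i j = A j i) (u v : Fin n → ℝ) :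
    edgeForm A u v = edgeForm A v u := by
  unfold edgeForm
  rw [Finset.sum_comm]
  refine Finset.sum_congr rfl fun i _ => Finset.sum_congr rfl fun j _ => ?_
  rw [hA j i]
  ring

theorem edgeForm_sub_smul_self (hA : ∀ i j, A i j = A j i) (x w : Fin n → ℝ) (t : ℝ) :
    edgeForm A (x - t • w) (x - t • w) =
      edgeForm A x x - 2 * t * edgeForm A w x + t ^ 2 * edgeForm A w w := by
  have h : edgeForm A (x - t • w) (x - t • w) =
      edgeForm A x x - t * edgeForm A w x - t * edgeForm A x w + t ^ 2 * edgeForm A w w := by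
    simp only [edgeForm, Finset.mul_sum, ← Finset.sum_sub_distrib, ← Finset.sum_add_distrib]
    refine Finset.sum_congr rfl fun i _ => Finset.sum_congr rfl fun j _ => ?_
    simp only [Pi.sub_apply, Pi.smul_apply, smul_eq_mul]
    ring
  rw [h, edgeForm_swap hA x w]
  ring

theorem triForm_sub_smul_self (hA : ∀ i j, A i j = A j i) (x w : Fin n → ℝ) (t : ℝ) :
    triForm A (x - t • w) (x - t • w) (x - t • w) =
      triForm A x x x - 3 * t * triForm A w x x + 3 * t ^ 2 * triForm A w w x -
        t ^ 3 * triForm A w w w := by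
  rw [triForm_sub_self hA]
  simp only [triForm_smul_left, triForm_swap_left hA _ (t • w), triForm_swap_right hA _ _ (t • w)]
  ring

theorem hasDerivAt_edgeForm_weight (hA : ∀ i j, A i j = A j i) (x w : Fin n → ℝ) :
    HasDerivAt (fun t : ℝ => edgeForm A (x - t • w) (x - t • w)) (-2 * edgeForm A w x) 0 := by
  simp only [edgeForm_sub_smul_self hA]
  have := (((hasDerivAt_id (0 : ℝ)).const_mul 2).mul_const (edgeForm A w x)).const_sub
    (edgeForm A x x) |>.add ((hasDerivAt_pow 2 (0 : ℝ)).mul_const (edgeForm A w w))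
  refine this.congr_deriv ?_
  simp

theorem hasDerivAt_triForm_weight (hA : ∀ i j, A i j = A j i) (x w : Fin n → ℝ) :
    HasDerivAt (fun t : ℝ => triForm A (x - t • w) (x - t • w) (x - t • w))
      (-3 * triForm A w x x) 0 := by
  simp only [triForm_sub_smul_self hA]
  have := (((hasDerivAt_id (0 : ℝ)).const_mul 3).mul_const (triForm A w x x)).const_sub
    (triForm A x x x) |>.add (((hasDerivAt_pow 2 (0 : ℝ)).const_mul 3).mul_const (triForm A w w x))
    |>.sub ((hasDerivAt_pow 3 (0 : ℝ)).mul_const (triForm A w w w))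
  refine this.congr_deriv ?_
  simp

theorem hasDerivAt_edgeForm_kernel (B : Fin n → Fin n → ℝ) (x : Fin n → ℝ) :
    HasDerivAt (fun t : ℝ => edgeForm (A - t • B) x x) (-edgeForm B x x) 0 := by
  have h (t : ℝ) : edgeForm (A - t • B) x x = edgeForm A x x - t * edgeForm B x x := by
    simp only [edgeForm, Finset.mul_sum, ← Finset.sum_sub_distrib]
    refine Finset.sum_congr rfl fun i _ => Finset.sum_congr rfl fun j _ => ?_
    simp only [Pi.sub_apply, Pi.smul_apply, smul_eq_mul]
    ring
  simp only [h]
  simpa using ((hasDerivAt_id (0 : ℝ)).mul_const (edgeForm B x x)).const_sub (edgeForm A x x)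

theorem hasDerivAt_triForm_kernel (hA : ∀ i j, A i j = A j i) (B : Fin n → Fin n → ℝ)
    (x : Fin n → ℝ) :
    HasDerivAt (fun t : ℝ => triForm (A - t • B) x x x)
      (-3 * ∑ i, ∑ j, B i j * (x i * x j) * wcodeg A x i j) 0 := by
  have hb (i j : Fin n) : HasDerivAt (fun t : ℝ => A i j - t * B i j) (-B i j) 0 := by
    simpa using ((hasDerivAt_id (0 : ℝ)).mul_const (B i j)).const_sub (A i j)
  have h : HasDerivAt (fun t : ℝ => triForm (A - t • B) x x x)
      (∑ i, ∑ j, ∑ k, (-(B i j * A j k * A i k) - A i j * B j k * A i k - A i j * A j k * B i k) *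
        (x i * x j * x k)) 0 := by
    unfold triForm
    refine HasDerivAt.fun_sum fun i _ => HasDerivAt.fun_sum fun j _ =>
      HasDerivAt.fun_sum fun k _ => ?_
    refine ((((hb i j).mul (hb j k)).mul (hb i k)).mul_const (x i * x j * x k)).congr_deriv ?_
    simp only [Pi.mul_apply, zero_mul, sub_zero]
    ring
  refine h.congr_deriv ?_
  have e1 : ∑ i, ∑ j, ∑ k, B i j * A j k * A i k * (x i * x j * x k) =
      ∑ i, ∑ j, B i j * (x i * x j) * wcodeg A x i j := by
    simp only [wcodeg, Finset.mul_sum]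
    refine Finset.sum_congr rfl fun i _ => Finset.sum_congr rfl fun j _ =>
      Finset.sum_congr rfl fun k _ => ?_
    ring
  have e2 : ∑ i, ∑ j, ∑ k, A i j * A j k * B i k * (x i * x j * x k) =
      ∑ i, ∑ j, B i j * (x i * x j) * wcodeg A x i j := by
    rw [← e1]
    refine Finset.sum_congr rfl fun i _ => ?_
    rw [Finset.sum_comm]
    refine Finset.sum_congr rfl fun j _ => Finset.sum_congr rfl fun k _ => ?_
    rw [hA k j]
    ring
  have e3 : ∑ i, ∑ j, ∑ k, A i j * B j k * A i k * (x i * x j * x k) =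
      ∑ i, ∑ j, B i j * (x i * x j) * wcodeg A x i j := by
    rw [← e2, Finset.sum_comm]
    refine Finset.sum_congr rfl fun i _ => Finset.sum_congr rfl fun j _ =>
      Finset.sum_congr rfl fun k _ => ?_
    rw [hA j i]
    ring
  have : -3 * ∑ i, ∑ j, B i j * (x i * x j) * wcodeg A x i j =
      - ∑ i, ∑ j, ∑ k, B i j * A j k * A i k * (x i * x j * x k) -
      ∑ i, ∑ j, ∑ k, A i j * B j k * A i k * (x i * x j * x k) -
      ∑ i, ∑ j, ∑ k, A i j * A j k * B i k * (x i * x j * x k) := by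
    rw [e1, e2, e3]
    ring
  rw [this]
  simp only [← Finset.sum_neg_distrib, ← Finset.sum_sub_distrib]
  refine Finset.sum_congr rfl fun i _ => Finset.sum_congr rfl fun j _ =>
      Finset.sum_congr rfl fun k _ => ?_
  ring

end

/-- Weightings supported on `S` of total weight `1` with edge weight in the scallop of `P`. -/
def scallopFeasible {n : ℕ} (S : Finset (Fin n)) (P : ℝ) :
    Set ((Fin n → Fin n → ℝ) × (Fin n → ℝ)) :=
  {z | IsKernel z.1 ∧ (∀ i, 0 ≤ z.2 i) ∧ (∀ i ∉ S, z.2 i = 0) ∧ ∑ i, z.2 i = 1 ∧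
    (P - 1) / (2 * P) ≤ edgeForm z.1 z.2 z.2 / 2 ∧ edgeForm z.1 z.2 z.2 / 2 ≤ P / (2 * (P + 1))}

/-- The excess of the triangle weight over the claimed minimum. -/
noncomputable def scallopGap {n : ℕ} (P : ℝ) (z : (Fin n → Fin n → ℝ) × (Fin n → ℝ)) : ℝ :=
  triForm z.1 z.2 z.2 z.2 / 6 - scallopTri P 1 (scallopRoot P (edgeForm z.1 z.2 z.2 / 2))

section

variable {n : ℕ} {A : Fin n → Fin n → ℝ}

theorem continuous_scallopGap (P : ℝ) : Continuous (scallopGap (n := n) P) := by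
  unfold scallopGap scallopTri scallopRoot edgeForm triForm
  fun_prop

theorem isCompact_scallopFeasible (S : Finset (Fin n)) (P : ℝ) :
    IsCompact (scallopFeasible S P) := by
  refine (isCompact_Icc (a := (0 : (Fin n → Fin n → ℝ) × (Fin n → ℝ))) (b := 1)).of_isClosed_subset
    ?_ ?_
  · have : scallopFeasible S P = {z | (∀ i, z.1 i i = 0) ∧ (∀ i j, 0 ≤ z.1 i j) ∧
        (∀ i j, z.1 i j ≤ 1) ∧ (∀ i j, z.1 i j = z.1 j i) ∧ (∀ i, 0 ≤ z.2 i) ∧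
        (∀ i ∉ S, z.2 i = 0) ∧ ∑ i, z.2 i = 1 ∧
        (P - 1) / (2 * P) ≤ edgeForm z.1 z.2 z.2 / 2 ∧
        edgeForm z.1 z.2 z.2 / 2 ≤ P / (2 * (P + 1))} := by
      ext z
      constructor
      · rintro ⟨⟨h1, h2, h3, h4⟩, h⟩
        exact ⟨h1, h2, h3, h4, h⟩
      · rintro ⟨h1, h2, h3, h4, h⟩
        exact ⟨⟨h1, h2, h3, h4⟩, h⟩
    rw [this]
    unfold edgeForm
    simp only [Set.ofPred_and, Set.ofPred_forall]
    refine IsClosed.inter ?_ <| IsClosed.inter ?_ <| IsClosed.inter ?_ <| IsClosed.inter ?_ <|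
      IsClosed.inter ?_ <| IsClosed.inter ?_ <| IsClosed.inter ?_ <| IsClosed.inter ?_ ?_
    · exact isClosed_iInter fun i => isClosed_eq (by fun_prop) (by fun_prop)
    · exact isClosed_iInter fun i => isClosed_iInter fun j => isClosed_le (by fun_prop) (by fun_prop)
    · exact isClosed_iInter fun i => isClosed_iInter fun j => isClosed_le (by fun_prop) (by fun_prop)
    · exact isClosed_iInter fun i => isClosed_iInter fun j => isClosed_eq (by fun_prop) (by fun_prop)
    · exact isClosed_iInter fun i => isClosed_le (by fun_prop) (by fun_prop)
    · exact isClosed_iInter fun i => isClosed_iInter fun _ => isClosed_eq (by fun_prop) (by fun_prop)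
    · exact isClosed_eq (by fun_prop) (by fun_prop)
    · exact isClosed_le (by fun_prop) (by fun_prop)
    · exact isClosed_le (by fun_prop) (by fun_prop)
  · rintro z ⟨hA, h0, -, h1, -⟩
    refine ⟨⟨fun i j => hA.nonneg i j, h0⟩, ⟨fun i j => hA.le_one i j, fun i => ?_⟩⟩
    exact (Finset.single_le_sum (fun i _ => h0 i) (Finset.mem_univ i)).trans_eq h1

theorem derivative_le_of_isMinOn {S : Finset (Fin n)} {P : ℝ} {x : Fin n → ℝ} (hP : 1 ≤ P)
    (hmin : IsMinOn (scallopGap P) (scallopFeasible S P) (A, x))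
    (hc1 : (P - 1) / (2 * P) < edgeForm A x x / 2) (hc2 : edgeForm A x x / 2 < P / (2 * (P + 1)))
    (hroot : 1 / (P + 1) < scallopRoot P (edgeForm A x x / 2))
    {B : ℝ → Fin n → Fin n → ℝ} {y : ℝ → Fin n → ℝ} (hB : B 0 = A) (hy : y 0 = x)
    (hfeas : ∀ᶠ t in nhdsWithin (0 : ℝ) (Set.Ioi 0), IsKernel (B t) ∧ (∀ i, 0 ≤ y t i) ∧
      (∀ i ∉ S, y t i = 0) ∧ ∑ i, y t i = 1) {e' t' : ℝ}
    (he : HasDerivAt (fun t => edgeForm (B t) (y t) (y t)) e' 0)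
    (ht : HasDerivAt (fun t => triForm (B t) (y t) (y t) (y t)) t' 0) :
    (P - 1) * scallopRoot P (edgeForm A x x / 2) * (e' / 2) ≤ t' / 6 := by
  have hgap : HasDerivAt (fun t => scallopGap P (B t, y t))
      (t' / 6 - (P - 1) * scallopRoot P (edgeForm A x x / 2) * (e' / 2)) 0 := by
    have h2 := he.div_const 2
    have h3 := hasDerivAt_scallop hP hroot
    have h4 := HasDerivAt.comp_of_eq (0 : ℝ) h3 h2 (by simp [hB, hy])
    exact (ht.div_const 6).sub h4
  have hcont : Filter.Tendsto (fun t => edgeForm (B t) (y t) (y t) / 2) (nhdsWithin 0 (Set.Ioi 0))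
      (nhds (edgeForm A x x / 2)) := by
    have := (he.continuousAt.tendsto.div_const 2).mono_left
      (nhdsWithin_le_nhds (s := Set.Ioi (0 : ℝ)))
    simpa [hB, hy] using this
  have hev : ∀ᶠ t in nhdsWithin (0 : ℝ) (Set.Ioi 0),
      0 ≤ t⁻¹ • (scallopGap P (B (0 + t), y (0 + t)) - scallopGap P (B 0, y 0)) := by
    filter_upwards [hfeas, hcont.eventually_const_le hc1, hcont.eventually_le_const hc2,
      self_mem_nhdsWithin] with t h1 h2 h3 h4
    have : scallopGap P (A, x) ≤ scallopGap P (B t, y t) :=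
      hmin ⟨h1.1, h1.2.1, h1.2.2.1, h1.2.2.2, h2, h3⟩
    rw [zero_add, hB, hy, smul_eq_mul]
    exact mul_nonneg (inv_nonneg.2 (le_of_lt h4)) (by linarith)
  have hlim := hgap.tendsto_slope_zero_right
  have := ge_of_tendsto hlim hev
  linarith

theorem wcodeg_le_of_isMinOn {S : Finset (Fin n)} {P : ℝ} {x : Fin n → ℝ} (hP : 1 ≤ P)
    (hz : (A, x) ∈ scallopFeasible S P)
    (hmin : IsMinOn (scallopGap P) (scallopFeasible S P) (A, x))
    (hc1 : (P - 1) / (2 * P) < edgeForm A x x / 2) (hc2 : edgeForm A x x / 2 < P / (2 * (P + 1)))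
    (hroot : 1 / (P + 1) < scallopRoot P (edgeForm A x x / 2)) (i j : Fin n)
    (hi : 0 < x i) (hj : 0 < x j) (hij : 0 < A i j) :
    wcodeg A x i j ≤ (P - 1) * scallopRoot P (edgeForm A x x / 2) := by
  obtain ⟨hA, hx, hS, h1, -⟩ := hz
  dsimp only at hA hx hS h1
  have hne : i ≠ j := by
    rintro rfl
    exact hij.ne' (hA.diag i)
  let B : Fin n → Fin n → ℝ := fun a b =>
    (if a = i then if b = j then 1 else 0 else 0) + (if a = j then if b = i then 1 else 0 else 0)
  have hBsum (f : Fin n → Fin n → ℝ) : ∑ a, ∑ b, B a b * f a b = f i j + f j i := by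
    simp only [B, add_mul, ite_mul, one_mul, zero_mul, Finset.sum_add_distrib]
    simp [Finset.sum_ite_irrel]
  have hBe : edgeForm B x x = 2 * (x i * x j) := by
    rw [edgeForm, hBsum]; ring
  have hBt : ∑ a, ∑ b, B a b * (x a * x b) * wcodeg A x a b = 2 * (x i * x j) * wcodeg A x i j := by
    simp only [mul_assoc (B _ _)]
    rw [hBsum, wcodeg_comm x j i]
    ring
  have key := derivative_le_of_isMinOn hP hmin hc1 hc2 hroot (B := fun t => A - t • B)
    (y := fun _ => x) (by simp) rfl ?_ (hasDerivAt_edgeForm_kernel B x)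
    (hasDerivAt_triForm_kernel hA.symm B x)
  · rw [hBe, hBt] at key
    refine le_of_mul_le_mul_left ?_ (mul_pos hi hj)
    linarith
  · filter_upwards [Ioo_mem_nhdsGT hij] with t ht
    refine ⟨⟨fun a => ?_, fun a b => ?_, fun a b => ?_, fun a b => ?_⟩, hx, hS, h1⟩
    all_goals simp only [Pi.sub_apply, Pi.smul_apply, smul_eq_mul, B]
    · have := hA.diag a
      split_ifs <;> simp_all
    · have := hA.nonneg a b
      have := hA.symm i j
      have := ht.2
      split_ifs <;> simp_all <;> linarith
    · have := hA.le_one a b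
      have := ht.1
      split_ifs <;> simp_all <;> linarith
    · rw [hA.symm a b]
      split_ifs <;> simp_all

theorem link_sub_le_of_isMinOn {S : Finset (Fin n)} {P : ℝ} {x : Fin n → ℝ} (hP : 1 ≤ P)
    (hz : (A, x) ∈ scallopFeasible S P)
    (hmin : IsMinOn (scallopGap P) (scallopFeasible S P) (A, x))
    (hc1 : (P - 1) / (2 * P) < edgeForm A x x / 2) (hc2 : edgeForm A x x / 2 < P / (2 * (P + 1)))
    (hroot : 1 / (P + 1) < scallopRoot P (edgeForm A x x / 2)) (i j : Fin n)
    (hi : 0 < x i) (hj : 0 < x j) :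
    edgeForm A (linkWeight A x i) (linkWeight A x i) / 2 -
        (P - 1) * scallopRoot P (edgeForm A x x / 2) * wdeg A x i ≤
      edgeForm A (linkWeight A x j) (linkWeight A x j) / 2 -
        (P - 1) * scallopRoot P (edgeForm A x x / 2) * wdeg A x j := by
  obtain ⟨hA, hx, hS, h1, -⟩ := hz
  dsimp only at hA hx hS h1
  let w : Fin n → ℝ := Pi.single i 1 - Pi.single j 1
  have hw (f : Fin n → ℝ) : ∑ k, w k * f k = f i - f j := by
    simp [w, sub_mul, Finset.sum_sub_distrib, Pi.single_apply]
  have key := derivative_le_of_isMinOn hP hmin hc1 hc2 hroot (B := fun _ => A)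
    (y := fun t => x - t • w) rfl (by simp) ?_ (hasDerivAt_edgeForm_weight hA.symm x w)
    (hasDerivAt_triForm_weight hA.symm x w)
  · rw [edgeForm_eq_sum_wdeg w x, triForm_eq_sum_link, hw, hw] at key
    linarith
  · filter_upwards [Ioo_mem_nhdsGT hi] with t ht
    refine ⟨hA, fun k => ?_, fun k hk => ?_, ?_⟩
    · have h2 : w k * t ≤ if k = i then t else 0 := by
        simp only [w, Pi.sub_apply, Pi.single_apply]
        split_ifs <;> linarith [ht.1]
      have h3 : (if k = i then t else 0) ≤ x k := by
        split_ifs with h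
        · rw [h]; exact ht.2.le
        · exact hx k
      simp only [Pi.sub_apply, Pi.smul_apply, smul_eq_mul]
      linarith
    · have hki : k ≠ i := by
        rintro rfl
        exact hi.ne' (hS k hk)
      have hkj : k ≠ j := by
        rintro rfl
        exact hj.ne' (hS k hk)
      simp [w, hki, hkj, hS k hk]
    · have := hw 1
      simp only [Pi.one_apply, mul_one, sub_self] at this
      simp only [Pi.sub_apply, Pi.smul_apply, smul_eq_mul, Finset.sum_sub_distrib, h1,
        ← Finset.mul_sum, this]
      simp

end

/-- The clique density bound for triangles, for weightings supported on `S`. -/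
def ScallopBound {n : ℕ} (S : Finset (Fin n)) : Prop :=
  ∀ (A : Fin n → Fin n → ℝ) (x : Fin n → ℝ), IsKernel A → (∀ i, 0 ≤ x i) → (∀ i ∉ S, x i = 0) →
    ∑ i, x i = 1 → ∀ p : ℕ, 1 ≤ p → ∀ u : ℝ, 1 / ((p : ℝ) + 1) ≤ u → u ≤ 1 / p →
      edgeForm A x x = 2 * scallopEdge p 1 u → 6 * scallopTri p 1 u ≤ triForm A x x x

section

variable {n : ℕ} {A : Fin n → Fin n → ℝ} {S : Finset (Fin n)}

theorem edgeForm_smul_self (A : Fin n → Fin n → ℝ) (t : ℝ) (x : Fin n → ℝ) :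
    edgeForm A (t • x) (t • x) = t ^ 2 * edgeForm A x x := by
  simp only [edgeForm, Finset.mul_sum, Pi.smul_apply, smul_eq_mul]
  refine Finset.sum_congr rfl fun i _ => Finset.sum_congr rfl fun j _ => ?_
  ring

theorem triForm_smul_self (A : Fin n → Fin n → ℝ) (t : ℝ) (x : Fin n → ℝ) :
    triForm A (t • x) (t • x) (t • x) = t ^ 3 * triForm A x x x := by
  simp only [triForm, Finset.mul_sum, Pi.smul_apply, smul_eq_mul]
  refine Finset.sum_congr rfl fun i _ => Finset.sum_congr rfl fun j _ =>
    Finset.sum_congr rfl fun k _ => ?_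
  ring

theorem ScallopBound.scallopTri_mul_le (h : ScallopBound S) (hA : IsKernel A) {y : Fin n → ℝ}
    (hy : ∀ i, 0 ≤ y i) (hS : ∀ i ∉ S, y i = 0) {d : ℝ} (hd : 0 < d) (h1 : ∑ i, y i = d)
    {p : ℕ} (hp : 1 ≤ p) {u : ℝ} (hu : 1 / ((p : ℝ) + 1) ≤ u) (hu' : u ≤ 1 / p)
    (hT : edgeForm A y y = 2 * scallopEdge p d (d * u)) :
    6 * scallopTri p d (d * u) ≤ triForm A y y y := by
  have h2 := h A (d⁻¹ • y) hA (fun i => mul_nonneg (inv_nonneg.2 hd.le) (hy i))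
    (fun i hi => by simp [hS i hi])
    (by simp only [Pi.smul_apply, smul_eq_mul, ← Finset.mul_sum, h1]; exact inv_mul_cancel₀ hd.ne')
    p hp u hu hu' (by
      rw [edgeForm_smul_self, hT, scallopEdge, scallopEdge]
      field_simp)
  rw [triForm_smul_self] at h2
  have h3 := mul_le_mul_of_nonneg_left h2 (pow_pos hd 3).le
  rw [← mul_assoc (d ^ 3) (d⁻¹ ^ 3), ← mul_pow, mul_inv_cancel₀ hd.ne', one_pow, one_mul] at h3
  refine le_trans (le_of_eq ?_) h3
  unfold scallopTri
  ring

theorem ScallopBound.scallopTri_sub_le (h : ScallopBound S) (hA : IsKernel A) {y : Fin n → ℝ}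
    (hy : ∀ i, 0 ≤ y i) (hS : ∀ i ∉ S, y i = 0) {d : ℝ} (hd1 : d ≤ 1) (h1 : ∑ i, y i = d)
    {q : ℕ} (hq : 1 ≤ q) {x z δ T : ℝ} (hx : 0 < x) (hz : 0 ≤ z) (hzx : z ≤ x)
    (hx1 : ((q : ℝ) + 1) * x ≤ 1) (hδ0 : 0 ≤ δ) (hδ : δ ≤ ((q : ℝ) + 1) * x * z * (x - z) ^ 2)
    (hT : T = scallopEdge q d x - δ) (hT2 : 2 * T ≤ q * x * d)
    (he : edgeForm A y y = 2 * T) :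
    6 * (scallopTri q d x - ((q : ℝ) - 1) / q * δ) ≤ triForm A y y y := by
  have hq1 : (1 : ℝ) ≤ q := by exact_mod_cast hq
  have hd0 : 0 ≤ d := h1 ▸ Finset.sum_nonneg fun i _ => hy i
  have ht0 := triForm_nonneg hA hy hy hy
  rcases le_or_gt T (((q : ℝ) - 1) / (2 * q) * d ^ 2) with hTq | hTq
  · have hG := goodman hA hy
    rw [he, h1] at hG
    have := scallopTri_lower_of_goodman hq1 hd0 hd1 hx hz hzx hx1 hδ0 hδ hT hT2 hTq
      (Q := triForm A y y y / 6) (by positivity) (by linarith)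
    linarith
  · have hd : 0 < d := by
      refine hd0.lt_of_ne fun h => ?_
      rw [← h] at hTq hT2
      norm_num at hTq hT2
      linarith
    have hup : T ≤ (q : ℝ) / (2 * (q + 1)) * d ^ 2 := by
      have : scallopEdge q d x =
          (q : ℝ) / (2 * (q + 1)) * d ^ 2 - (q : ℝ) / (2 * (q + 1)) * (d - (q + 1) * x) ^ 2 := by
        unfold scallopEdge
        field_simp
        ring
      have : 0 ≤ (q : ℝ) / (2 * (q + 1)) * (d - (q + 1) * x) ^ 2 := by positivity
      linarith
    obtain ⟨hu, hu', hu2⟩ := scallopRoot_spec hq1 (c := T / d ^ 2)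
      ((le_div_iff₀ (by positivity)).2 hTq.le) ((div_le_iff₀ (by positivity)).2 hup)
    set u := scallopRoot q (T / d ^ 2)
    have hTu : scallopEdge q d (d * u) = T := by
      rw [eq_div_iff (by positivity)] at hu2
      rw [← hu2]
      unfold scallopEdge
      ring
    rcases hq.eq_or_lt with rfl | hq2
    · simpa [scallopTri] using ht0
    · have h3 := h.scallopTri_mul_le hA hy hS hd h1 hq hu hu' (by rw [hTu, he])
      have h4 := scallopTri_lower_of_scallop (q := q) (by exact_mod_cast hq2) hd0 hd1 hx hδ0
        (u := d * u) (by rw [hTu, hT]) (by rw [hTu]; exact hT2)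
        (by rw [div_eq_mul_one_div]; gcongr) (by rw [div_eq_mul_one_div]; gcongr)
      linarith

theorem scallopGap_nonneg (hlink : ∀ v ∈ S, ScallopBound (S.erase v)) {q : ℕ} (hq : 1 ≤ q)
    {z : (Fin n → Fin n → ℝ) × (Fin n → ℝ)} (hz : z ∈ scallopFeasible S ((q : ℝ) + 1)) :
    0 ≤ scallopGap ((q : ℝ) + 1) z := by
  have hq1 : (1 : ℝ) ≤ q := by exact_mod_cast hq
  have hq0 : (0 : ℝ) < q := by linarith
  obtain ⟨⟨A, x⟩, hAx, hmin⟩ := (isCompact_scallopFeasible S ((q : ℝ) + 1)).exists_isMinOn ⟨z, hz⟩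
    (continuous_scallopGap _).continuousOn
  refine le_trans ?_ (hmin hz)
  by_contra! hneg
  obtain ⟨hA, hx, hS, h1, hc1, hc2⟩ := id hAx
  dsimp only at hA hx hS h1 hc1 hc2
  obtain ⟨hξ1, hξ2, hξc⟩ := scallopRoot_spec (by linarith) hc1 hc2
  unfold scallopGap at hneg
  dsimp only at hneg
  have hwc := wcodeg_le_of_isMinOn (by linarith) hAx hmin
  have hld := link_sub_le_of_isMinOn (by linarith) hAx hmin
  set ξ := scallopRoot ((q : ℝ) + 1) (edgeForm A x x / 2) with hξ
  set t := triForm A x x x / 6 with ht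
  have hξ0 : 0 < ξ := lt_of_lt_of_le (by positivity) hξ1
  rw [div_le_iff₀ (by positivity)] at hξ1
  rw [le_div_iff₀' (by positivity)] at hξ2
  have hδ : 3 * (scallopTri (q + 1) 1 ξ - t) ≤
      ((q : ℝ) + 1) * ξ * (1 - (q + 1) * ξ) * (ξ - (1 - (q + 1) * ξ)) ^ 2 := by
    refine scallopTri_le_of_goodman ?_
    have := goodman hA hx
    rw [h1] at this
    rw [hξc]
    linarith
  have hδ0 : 0 < 3 * (scallopTri (q + 1) 1 ξ - t) := by linarith
  have hpos := hδ0.trans_le hδ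
  have hy0 : (1 - ((q : ℝ) + 1) * ξ) ≠ 0 := fun h => by simp [h] at hpos
  have hyξ : (ξ - (1 - ((q : ℝ) + 1) * ξ)) ≠ 0 := fun h => by simp [h] at hpos
  have hy0' : 0 < 1 - ((q : ℝ) + 1) * ξ := lt_of_le_of_ne (by linarith) hy0.symm
  have hyξ' : 0 < ξ - (1 - ((q : ℝ) + 1) * ξ) := lt_of_le_of_ne (by linarith) hyξ.symm
  have hroot : 1 / ((q : ℝ) + 1 + 1) < ξ := by
    rw [div_lt_iff₀ (by positivity)]
    linarith
  have hc1' : ((q : ℝ) + 1 - 1) / (2 * (q + 1)) < edgeForm A x x / 2 := by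
    rw [← hξc, div_lt_iff₀ (by positivity)]
    unfold scallopEdge
    nlinarith [mul_pos hy0' hyξ']
  have hc2' : edgeForm A x x / 2 < ((q : ℝ) + 1) / (2 * (q + 1 + 1)) := by
    rw [← hξc, lt_div_iff₀ (by positivity)]
    unfold scallopEdge
    nlinarith [pow_pos hyξ' 2]
  replace hwc := hwc hc1' hc2' hroot
  replace hld := hld hc1' hc2' hroot
  rw [add_sub_cancel_right] at hwc hld
  set δ := 3 * (scallopTri (q + 1) 1 ξ - t) with hδdef
  have hlink_eq (i : Fin n) (hi : 0 < x i) :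
      edgeForm A (linkWeight A x i) (linkWeight A x i) / 2 =
        q * ξ * wdeg A x i + (3 * t - q * ξ * edgeForm A x x) := by
    have key : ∑ j, x j * (edgeForm A (linkWeight A x j) (linkWeight A x j) / 2 -
        q * ξ * wdeg A x j) = ∑ j, x j * (edgeForm A (linkWeight A x i) (linkWeight A x i) / 2 -
        q * ξ * wdeg A x i) := by
      refine Finset.sum_congr rfl fun j _ => ?_
      rcases (hx j).eq_or_lt with hj | hj
      · simp [← hj]
      · rw [le_antisymm (hld i j hi hj) (hld j i hj hi)]
    rw [← Finset.sum_mul, h1, one_mul] at key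
    have h2 : ∑ j, x j * (edgeForm A (linkWeight A x j) (linkWeight A x j) / 2 -
        q * ξ * wdeg A x j) = 3 * t - q * ξ * edgeForm A x x := by
      rw [ht, triForm_eq_sum_link, edgeForm_eq_sum_wdeg, Finset.sum_div, Finset.mul_sum,
        Finset.mul_sum, ← Finset.sum_sub_distrib]
      refine Finset.sum_congr rfl fun j _ => ?_
      ring
    linarith
  have hμ : 3 * t - q * ξ * edgeForm A x x = -(q * (q + 1) / 2 * ξ ^ 2) - δ := by
    have : edgeForm A x x = 2 * scallopEdge (q + 1) 1 ξ := by linarith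
    rw [this, hδdef]
    unfold scallopTri scallopEdge
    ring
  have hquad := quad_le_of_stationary hA hx h1 hlink_eq fun i j hi hj hij => hwc i j hi hj hij
  have hvert (v : Fin n) : x v * (6 * (scallopTri q (wdeg A x v) ξ - ((q : ℝ) - 1) / q * δ)) ≤
      x v * triForm A (linkWeight A x v) (linkWeight A x v) (linkWeight A x v) := by
    rcases (hx v).eq_or_lt with hv | hv
    · simp [← hv]
    have hvS : v ∈ S := by
      by_contra h
      exact hv.ne' (hS v h)
    have hl0 (i : Fin n) : 0 ≤ linkWeight A x v i := mul_nonneg (hA.nonneg _ _) (hx _)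
    refine mul_le_mul_of_nonneg_left ?_ hv.le
    refine (hlink v hvS).scallopTri_sub_le hA hl0 (fun i hi => ?_) ?_ (sum_linkWeight x v) hq hξ0
      hy0'.le (by linarith) hξ2 hδ0.le hδ
      (T := edgeForm A (linkWeight A x v) (linkWeight A x v) / 2) ?_ ?_ (by ring)
    · by_cases hiv : i = v
      · simp [linkWeight, hiv, hA.diag]
      · have : i ∉ S := fun h => hi (Finset.mem_erase.2 ⟨hiv, h⟩)
        simp [linkWeight, hS i this]
    · rw [← h1]
      exact Finset.sum_le_sum fun i _ => mul_le_of_le_one_left (hx i) (hA.le_one _ _)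
    · rw [hlink_eq v hv, hμ]
      unfold scallopEdge
      ring
    · rw [link_eq_sum_wcodeg, mul_div_cancel₀ _ two_ne_zero, wdeg, Finset.mul_sum]
      refine Finset.sum_le_sum fun j _ => ?_
      rcases (hA.nonneg v j).eq_or_lt with h0 | h0
      · simp [← h0]
      rcases (hx j).eq_or_lt with hj | hj
      · simp [← hj]
      rw [mul_comm (q * ξ : ℝ)]
      exact mul_le_mul_of_nonneg_left (hwc v j hv hj h0) (by positivity)
  have hsum := (Finset.sum_le_sum fun v _ => hvert v).trans hquad
  have haff : ∑ v, x v * (6 * (scallopTri q (wdeg A x v) ξ - ((q : ℝ) - 1) / q * δ)) =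
      6 * (scallopTri q (edgeForm A x x) ξ - ((q : ℝ) - 1) / q * δ) := by
    have (v : Fin n) : x v * (6 * (scallopTri q (wdeg A x v) ξ - ((q : ℝ) - 1) / q * δ)) =
        3 * q * (q - 1) * ξ ^ 2 * (x v * wdeg A x v) -
          x v * (2 * q * (q - 1) * (q + 1) * ξ ^ 3 + 6 * (((q : ℝ) - 1) / q * δ)) := by
      unfold scallopTri
      ring
    simp only [this]
    rw [Finset.sum_sub_distrib, ← Finset.mul_sum, ← edgeForm_eq_sum_wdeg, ← Finset.sum_mul, h1]
    unfold scallopTri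
    ring
  rw [haff] at hsum
  have hE : edgeForm A x x = 2 * scallopEdge (q + 1) 1 ξ := by linarith
  have h6 : triForm A x x x = 6 * t := by linarith
  rw [hE, h6] at hsum
  have := scallopTri_le_of_quad_bound hq1 hξ2 (by linarith) (t := t)
    (by rw [← hδdef]; linarith)
  linarith

theorem scallopBound (S : Finset (Fin n)) : ScallopBound S := by
  induction S using Finset.strongInduction with
  | H S ih =>
    intro A x hA hx hS h1 p hp u hu hu' hT
    obtain ⟨q, rfl⟩ := Nat.exists_eq_add_of_le' hp
    rcases Nat.eq_zero_or_pos q with rfl | hq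
    · simpa [scallopTri] using triForm_nonneg hA hx hx hx
    push_cast at hu hu' hT ⊢
    have hq1 : (0 : ℝ) < q := by exact_mod_cast hq
    have hE : edgeForm A x x / 2 = scallopEdge (q + 1) 1 u := by linarith
    rw [le_div_iff₀ (by positivity)] at hu'
    have hu2 := (div_le_iff₀ (by positivity)).1 hu
    have := scallopGap_nonneg (S := S) (fun v hv => ih _ (Finset.erase_ssubset hv)) hq
      (z := (A, x)) ⟨hA, hx, hS, h1, ?_, ?_⟩
    · simp only [scallopGap, hE] at this
      rw [scallopRoot_scallopEdge (by linarith) hu] at this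
      linarith
    · dsimp only
      rw [hE, div_le_iff₀ (by positivity)]
      unfold scallopEdge
      nlinarith [mul_nonneg (sub_nonneg.2 hu') (sub_nonneg.2 hu2)]
    · dsimp only
      rw [hE, le_div_iff₀ (by positivity)]
      unfold scallopEdge
      nlinarith [sq_nonneg (u * ((q : ℝ) + 1 + 1) - 1)]

end

section

variable {n : ℕ} {A : Fin n → Fin n → ℝ}

theorem sum_powersetCard_succ {ι : Type*} [Fintype ι] [DecidableEq ι] (r : ℕ)
    (F : Finset ι → ℝ) :
    ((r : ℝ) + 1) * ∑ s ∈ Finset.powersetCard (r + 1) Finset.univ, F s =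
      ∑ t ∈ Finset.powersetCard r Finset.univ, ∑ i ∈ tᶜ, F (insert i t) := by
  have h : ((r : ℝ) + 1) * ∑ s ∈ Finset.powersetCard (r + 1) Finset.univ, F s =
      ∑ s ∈ Finset.powersetCard (r + 1) Finset.univ, ∑ _i ∈ s, F s := by
    rw [Finset.mul_sum]
    refine Finset.sum_congr rfl fun s hs => ?_
    rw [Finset.sum_const, (Finset.mem_powersetCard.1 hs).2, nsmul_eq_mul]
    push_cast
    rfl
  rw [h, Finset.sum_sigma', Finset.sum_sigma']
  refine Finset.sum_bij' (fun a _ => ⟨a.1.erase a.2, a.2⟩) (fun a _ => ⟨insert a.2 a.1, a.2⟩)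
    ?_ ?_ ?_ ?_ ?_
  · rintro ⟨s, i⟩ h
    simp only [Finset.mem_sigma, Finset.mem_powersetCard_univ] at h
    simp [Finset.card_erase_of_mem h.2, h.1]
  · rintro ⟨s, i⟩ h
    simp only [Finset.mem_sigma, Finset.mem_powersetCard_univ, Finset.mem_compl] at h
    simp [Finset.card_insert_of_notMem h.2, h.1]
  · rintro ⟨s, i⟩ h
    simp only [Finset.mem_sigma] at h
    simp [Finset.insert_erase h.2]
  · rintro ⟨s, i⟩ h
    simp only [Finset.mem_sigma, Finset.mem_compl] at h
    simp [Finset.erase_insert h.2]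
  · rintro ⟨s, i⟩ h
    simp only [Finset.mem_sigma] at h
    simp [Finset.insert_erase h.2]

theorem sum_powersetCard_one {ι : Type*} [Fintype ι] [DecidableEq ι] (F : Finset ι → ℝ) :
    ∑ s ∈ Finset.powersetCard 1 Finset.univ, F s = ∑ i, F {i} := by
  simp [Finset.powersetCard_one]

theorem L_one (A : Fin n → Fin n → ℝ) (x : Fin n → ℝ) : L n 1 A x = ∑ i, x i := by
  rw [L, sum_powersetCard_one]
  simp [Finset.filter_singleton]

theorem edgeForm_eq_two_mul_L (hA : IsKernel A) (x : Fin n → ℝ) :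
    edgeForm A x x = 2 * L n 2 A x := by
  have h := sum_powersetCard_succ 1 fun X : Finset (Fin n) =>
    (∏ i ∈ X, ∏ j ∈ X.filter (fun j => i < j), A i j) * ∏ i ∈ X, x i
  rw [sum_powersetCard_one] at h
  norm_num only at h
  rw [L, h, edgeForm]
  refine Finset.sum_congr rfl fun i _ => ?_
  rw [← Finset.sum_subset (Finset.subset_univ ({i}ᶜ : Finset (Fin n)))]
  · refine Finset.sum_congr rfl fun j hj => ?_
    have hji : j ≠ i := by simpa using hj
    simp only [Finset.prod_filter, Finset.prod_insert (Finset.notMem_singleton.2 hji),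
      Finset.prod_singleton, lt_self_iff_false, if_false]
    rcases hji.lt_or_gt with h | h
    · simp only [h, h.not_gt, if_true, if_false, hA.symm i j]; ring
    · simp only [h, h.not_gt, if_true, if_false]; ring
  · intro j _ hj
    have hji : j = i := by simpa using hj
    simp [hji, hA.diag]

theorem triForm_eq_six_mul_L (hA : IsKernel A) (x : Fin n → ℝ) :
    triForm A x x x = 6 * L n 3 A x := by
  let F := fun X : Finset (Fin n) =>
    (∏ i ∈ X, ∏ j ∈ X.filter (fun j => i < j), A i j) * ∏ i ∈ X, x i
  have h := sum_powersetCard_succ 2 F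
  have h' := sum_powersetCard_succ 1 fun X : Finset (Fin n) => ∑ i ∈ Xᶜ, F (insert i X)
  rw [sum_powersetCard_one] at h'
  norm_num only at h h'
  have hL : L n 3 A x = ∑ s ∈ Finset.powersetCard 3 Finset.univ, F s := rfl
  rw [hL, show (6 : ℝ) = 2 * 3 by norm_num, mul_assoc, h, h', triForm]
  refine Finset.sum_congr rfl fun i _ => ?_
  rw [← Finset.sum_subset (Finset.subset_univ ({i}ᶜ : Finset (Fin n)))]
  · refine Finset.sum_congr rfl fun j hj => ?_
    have hji : j ≠ i := by simpa using hj
    rw [← Finset.sum_subset (Finset.subset_univ ({j, i}ᶜ : Finset (Fin n)))]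
    · refine Finset.sum_congr rfl fun k hk => ?_
      have hk' : k ∉ ({j, i} : Finset (Fin n)) := by simpa using hk
      obtain ⟨hkj, hki⟩ : k ≠ j ∧ k ≠ i := by simpa using hk
      simp only [F, Finset.prod_filter, Finset.prod_insert hk',
        Finset.prod_insert (Finset.notMem_singleton.2 hji),
        Finset.prod_singleton, lt_self_iff_false, if_false]
      have e (a b : Fin n) (hab : a ≠ b) :
          (if a < b then A a b else 1) * (if b < a then A b a else 1) = A b a := by
        rcases hab.lt_or_gt with h | h
        · simp [h, h.not_gt, hA.symm b a]
        · simp [h, h.not_gt]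
      calc
        _ = ((if j < i then A j i else 1) * (if i < j then A i j else 1)) *
            ((if k < j then A k j else 1) * (if j < k then A j k else 1)) *
            ((if k < i then A k i else 1) * (if i < k then A i k else 1)) *
            (x i * x j * x k) := by rw [e j i hji, e k j hkj, e k i hki]
        _ = _ := by ring
    · intro k _ hk
      have hk' : k = j ∨ k = i := by
        by_contra hne
        exact hk (by simpa using hne)
      rcases hk' with rfl | rfl <;> simp [hA.diag]
  · intro j _ hj
    have hji : j = i := by simpa using hj
    simp [hji, hA.diag]

end

theorem phiF_three_eq_scallopTri {c : ℝ} (h3 : 3 ≤ xi c) :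
    phiF 3 c = scallopTri ((xi c : ℝ) - 1) 1 (xval c) := by
  have hs : (xi c : ℝ) ≠ 0 := by
    have : (xi c) ≠ 0 := by omega
    exact_mod_cast this
  have hy : yval c = 1 - ((xi c : ℝ) - 1) * xval c := by
    unfold yval xval
    field_simp
    ring
  have hm : ((xi c - 1 : ℕ) : ℝ) = (xi c : ℝ) - 1 := by
    push_cast [show 1 ≤ xi c by omega]; rfl
  have hch : ∀ m : ℕ, (m.choose 3 : ℝ) = m * (m - 1) * (m - 2) / 6 := by
    intro m
    induction m with
    | zero => simp
    | succ m ih =>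
      rw [Nat.choose_succ_succ, Nat.cast_add, ih, Nat.cast_choose_two]
      push_cast
      ring
  rw [phiF, hy, hch, show 3 - 1 = 2 from rfl, Nat.cast_choose_two, hm, scallopTri]
  ring

theorem xval_eq_scallopRoot {c : ℝ} : xval c = scallopRoot ((xi c : ℝ) - 1) c := by
  rw [xval, sqc, scallopRoot, sub_add_cancel]
  ring

/-- The bound of `scallopBound` is attained by `p` weights `u` and one weight `1 - p * u` on the
complete graph. -/
theorem exists_extremal (p : ℕ) {u : ℝ} (hu : 0 ≤ u) (hu' : p * u ≤ 1) :
    ∃ (A : Fin (p + 1) → Fin (p + 1) → ℝ) (x : Fin (p + 1) → ℝ), IsKernel A ∧ (∀ i, 0 ≤ x i) ∧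
      ∑ i, x i = 1 ∧ edgeForm A x x = 2 * scallopEdge p 1 u ∧
      triForm A x x x = 6 * scallopTri p 1 u := by
  let x : Fin (p + 1) → ℝ := Fin.snoc (fun _ : Fin p => u) (1 - p * u)
  have hsum (r : ℕ) : ∑ i, x i ^ r = p * u ^ r + (1 - p * u) ^ r := by
    simp [x, Fin.sum_univ_castSucc]
  have h1 : ∑ i, x i = 1 := by
    have := hsum 1
    simp only [pow_one] at this
    linarith
  let A : Fin (p + 1) → Fin (p + 1) → ℝ := fun i j => if i = j then 0 else 1
  have hA : IsKernel A := by
    refine ⟨fun i => by simp [A], fun i j => ?_, fun i j => ?_, fun i j => by simp [A, eq_comm]⟩ <;>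
      simp only [A] <;> split_ifs <;> norm_num
  have hlink (i j k : Fin (p + 1)) : A i j * A j k * A i k =
      1 - (if i = j then 1 else 0) - (if j = k then 1 else 0) - (if i = k then 1 else 0) +
        2 * (if i = j then if j = k then 1 else 0 else 0) := by
    simp only [A]
    (split_ifs <;> simp_all); norm_num
  refine ⟨A, x, hA, fun i => ?_, h1, ?_, ?_⟩
  · refine Fin.lastCases ?_ (fun i => ?_) i
    · simpa [x] using hu'
    · simpa [x] using hu
  · have h (i j : Fin (p + 1)) : A i j * (x i * x j) =
        x i * x j - if i = j then x i * x j else 0 := by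
      simp only [A]
      split_ifs <;> simp
    simp only [edgeForm, h, Finset.sum_sub_distrib, ← Finset.mul_sum, h1]
    simp only [mul_one, h1, Finset.sum_ite_eq, Finset.mem_univ, if_true, ← sq, hsum 2]
    unfold scallopEdge
    ring
  · have h2 : triForm A x x x = 1 - 3 * ∑ i, x i ^ 2 + 2 * ∑ i, x i ^ 3 := by
      have (i j k : Fin (p + 1)) : A i j * A j k * A i k * (x i * x j * x k) =
          x i * x j * x k - (if i = j then x i * x j * x k else 0) -
          (if j = k then x i * x j * x k else 0) - (if i = k then x i * x j * x k else 0) +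
          2 * (if i = j then if j = k then x i * x j * x k else 0 else 0) := by
        rw [hlink]
        split_ifs <;> ring
      simp only [triForm, this, Finset.sum_sub_distrib, Finset.sum_add_distrib, ← Finset.mul_sum,
        h1, Finset.sum_ite_eq, Finset.sum_ite_irrel, Finset.sum_const_zero, Finset.mem_univ,
        if_true, mul_one]
      have e1 (i : Fin (p + 1)) : x i * x i = x i ^ 2 := by ring
      have e2 (i : Fin (p + 1)) : ∑ j, x i * x j * x i = x i ^ 2 := by
        rw [← Finset.sum_mul, ← Finset.mul_sum, h1]; ring
      have e3 (i : Fin (p + 1)) : ∑ j, x i * x j * x j = x i * ∑ j, x j ^ 2 := by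
        rw [Finset.mul_sum]
        exact Finset.sum_congr rfl fun j _ => by ring
      have e4 (i : Fin (p + 1)) : x i ^ 2 * x i = x i ^ 3 := by ring
      simp only [e1, e2, e3, e4, ← Finset.sum_mul, h1]
      ring
    rw [h2, hsum, hsum]
    unfold scallopTri
    ring

theorem phi_three_eq (c : ℝ) (hc : c ∈ Set.Ioo (0 : ℝ) (1 / 2)) (n : ℕ)
    (h3 : 3 ≤ xi c) (hxn : xi c ≤ n) :
    phi 3 n c = phiF 3 c := by
  obtain ⟨p, hp⟩ : ∃ p, xi c = p + 1 := ⟨xi c - 1, by omega⟩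
  have hp2 : 2 ≤ p := by omega
  have hp2' : (2 : ℝ) ≤ p := by exact_mod_cast hp2
  have h2c : 0 < 1 - 2 * c := by linarith [hc.2]
  have hle : 1 / (1 - 2 * c) ≤ p + 1 := by
    have := Nat.le_ceil (1 / (1 - 2 * c))
    rw [← xi, hp] at this
    exact_mod_cast this
  have hlt : (p : ℝ) < 1 / (1 - 2 * c) := by
    refine Nat.lt_ceil.1 ?_
    rw [← xi, hp]
    exact Nat.lt_succ_self p
  rw [div_le_iff₀ h2c] at hle
  rw [lt_div_iff₀ h2c] at hlt
  have hP : (xi c : ℝ) - 1 = p := by rw [hp]; push_cast; ring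
  rw [phiF_three_eq_scallopTri h3, xval_eq_scallopRoot, hP]
  obtain ⟨hu, hu', huc⟩ := scallopRoot_spec (P := p) (c := c) (by linarith)
    (by rw [div_le_iff₀ (by positivity)]; linarith) (by rw [le_div_iff₀ (by positivity)]; linarith)
  set u := scallopRoot p c
  refine IsLeast.csInf_eq ⟨?_, ?_⟩
  · obtain ⟨A, x, hA, hx, h1, he, ht⟩ := exists_extremal p (u := u)
      (le_trans (by positivity) hu) ((le_div_iff₀' (by positivity)).1 hu')
    rw [edgeForm_eq_two_mul_L hA] at he
    rw [triForm_eq_six_mul_L hA] at ht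
    exact ⟨p + 1, by omega, by omega, A, x, ⟨hA.diag, hA.nonneg, hA.le_one, hA.symm, hx,
      (L_one A x).trans h1, by linarith⟩, by linarith⟩
  · rintro v ⟨k, -, -, A, x, ⟨hd, h0, hl, hs, hx, h1, h2⟩, rfl⟩
    have hA : IsKernel A := ⟨hd, h0, hl, hs⟩
    have := scallopBound Finset.univ A x hA hx (fun i hi => absurd (Finset.mem_univ i) hi)
      ((L_one A x).symm.trans h1) p (by omega) u hu hu'
      (by rw [edgeForm_eq_two_mul_L hA, h2, huc])
    rw [triForm_eq_six_mul_L hA] at this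
    linarith
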